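/- (Robinson's alternative) Let σ be a real structure on ℂl(V), let K be an irreducible ℂl(V)-module (via a representation ρ), and let (·,·)^K be a σ-compatible Krein product on K. If the quadratic form Q_σ on V is positive definite, then (·,·)^K is definite (either positive definite or negative definite); if Q_σ is not positive definite, then (·,·)^K is neutral. -/

import Mathlib

noncomputable section

open TensorProduct

variable {V : Type*} [AddCommGroup V] [Module ℝ V]

/-- `ℂl(V)`: the complexified Clifford algebra of `(V, Q)` (convention `v² = Q(v)·1`). -/
abbrev CCl (Q : QuadraticForm ℝ V) := CliffordAlgebra (Q.baseChange ℂ)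

/-- The canonical embedding of the real vector space `V` into `ℂl(V)`. -/
def ιr (Q : QuadraticForm ℝ V) (v : V) : CCl Q :=
  CliffordAlgebra.ι (Q.baseChange ℂ) ((1 : ℂ) ⊗ₜ[ℝ] v)

/-- `V^ℂ`: the complexification of `V`, sitting inside `ℂl(V)`. -/
def VC (Q : QuadraticForm ℝ V) : Submodule ℂ (CCl Q) :=
  LinearMap.range (CliffordAlgebra.ι (Q.baseChange ℂ))

/-- A real structure on `ℂl(V)`: an involutive conjugate-linear algebra automorphism
stabilizing `V^ℂ`. -/
structure RealStructure (Q : QuadraticForm ℝ V) where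
  toFun : CCl Q → CCl Q
  map_add' : ∀ x y, toFun (x + y) = toFun x + toFun y
  map_mul' : ∀ x y, toFun (x * y) = toFun x * toFun y
  map_smul' : ∀ (z : ℂ) (x : CCl Q), toFun (z • x) = (starRingEnd ℂ z) • toFun x
  map_one' : toFun 1 = 1
  invol : ∀ x, toFun (toFun x) = x
  stable : ∀ x ∈ VC Q, toFun x ∈ VC Q

namespace RealStructure

theorem map_zero' {Q : QuadraticForm ℝ V} (σ : RealStructure Q) : σ.toFun 0 = 0 := by
  have h := σ.map_smul' 0 0
  simpa using h

end RealStructure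

/-- The fixed points of a real structure, as a real submodule of `ℂl(V)`. -/
def fixedPoints {Q : QuadraticForm ℝ V} (σ : RealStructure Q) : Submodule ℝ (CCl Q) where
  carrier := {x | σ.toFun x = x}
  add_mem' := by
    intro a b ha hb
    simp only [Set.mem_setOf_eq] at *
    rw [σ.map_add', ha, hb]
  zero_mem' := σ.map_zero'
  smul_mem' := by
    intro r x hx
    simp only [Set.mem_setOf_eq] at *
    rw [← Complex.coe_smul, σ.map_smul', hx]
    simp [Complex.conj_ofReal]

/-- `V_σ = {w ∈ V^ℂ : σ(w) = w}`, as a real submodule of `ℂl(V)`. -/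
def VFix {Q : QuadraticForm ℝ V} (σ : RealStructure Q) : Submodule ℝ (CCl Q) :=
  (VC Q).restrictScalars ℝ ⊓ fixedPoints σ

/-- Multiplication by `i`, as a real-linear endomorphism of `ℂl(V)`. -/
def mulI (Q : QuadraticForm ℝ V) : CCl Q →ₗ[ℝ] CCl Q where
  toFun x := Complex.I • x
  map_add' x y := smul_add _ x y
  map_smul' r x := smul_comm Complex.I r x

/-- The real subspace `V ⊆ V^ℂ ⊆ ℂl(V)`. -/
def Vreal (Q : QuadraticForm ℝ V) : Submodule ℝ (CCl Q) :=
  Submodule.span ℝ (Set.range (ιr Q))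

/-- The canonical real structure `c` (characterized by fixing `V` pointwise). -/
def IsCanonicalC {Q : QuadraticForm ℝ V} (c : RealStructure Q) : Prop :=
  ∀ v : V, c.toFun (ιr Q v) = ιr Q v

/-- `σ` is admissible iff it commutes with the canonical real structure `c`. -/
def Admissible {Q : QuadraticForm ℝ V} (c σ : RealStructure Q) : Prop :=
  ∀ x, σ.toFun (c.toFun x) = c.toFun (σ.toFun x)

/-- Nondegeneracy of a real quadratic form, via its polar form. -/
def QFNondeg (Q : QuadraticForm ℝ V) : Prop :=
  ∀ v : V, (∀ w : V, QuadraticMap.polar Q v w = 0) → v = 0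

/-- A hermitian sesquilinear form (conjugate-linear in the first argument). -/
structure SesqForm (K : Type*) [AddCommGroup K] [Module ℂ K] where
  form : K → K → ℂ
  add_left : ∀ x y z : K, form (x + y) z = form x z + form y z
  add_right : ∀ x y z : K, form x (y + z) = form x y + form x z
  smul_left : ∀ (a : ℂ) (x y : K), form (a • x) y = starRingEnd ℂ a * form x y
  smul_right : ∀ (a : ℂ) (x y : K), form x (a • y) = a * form x y
  herm : ∀ x y : K, form y x = starRingEnd ℂ (form x y)

section KreinDefs

variable {K : Type*} [AddCommGroup K] [Module ℂ K]

/-- Nondegeneracy: a nondegenerate hermitian form is a Krein product. -/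
def SesqForm.Nondeg (h : SesqForm K) : Prop :=
  ∀ x : K, (∀ y : K, h.form x y = 0) → x = 0

/-- Positive definiteness of a sesquilinear form. -/
def FPosDef (f : K → K → ℂ) : Prop := ∀ x : K, x ≠ 0 → ∃ r : ℝ, 0 < r ∧ f x x = r

/-- Negative definiteness of a sesquilinear form. -/
def FNegDef (f : K → K → ℂ) : Prop := ∀ x : K, x ≠ 0 → ∃ r : ℝ, r < 0 ∧ f x x = r

/-- Definiteness of a sesquilinear form. -/
def FDefinite (f : K → K → ℂ) : Prop := FPosDef f ∨ FNegDef f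

/-- `f` is neutral: it admits an orthogonal decomposition into a positive definite
and a negative definite part of equal dimensions (equal indices of inertia). -/
def FNeutral (f : K → K → ℂ) : Prop :=
  ∃ P N : Submodule ℂ K, P ⊓ N = ⊥ ∧ P ⊔ N = ⊤
    ∧ (∀ x ∈ P, ∀ y ∈ N, f x y = 0)
    ∧ (∀ x ∈ P, x ≠ 0 → ∃ r : ℝ, 0 < r ∧ f x x = r)
    ∧ (∀ y ∈ N, y ≠ 0 → ∃ r : ℝ, r < 0 ∧ f y y = r)
    ∧ Module.finrank ℂ P = Module.finrank ℂ N

end KreinDefs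

section Rep

variable {V : Type*} [AddCommGroup V] [Module ℝ V]
variable {Q : QuadraticForm ℝ V} {K : Type*} [AddCommGroup K] [Module ℂ K]

/-- σ-compatibility of a representation with a hermitian form:
`(ρ(a)ψ, φ) = (ψ, ρ(a^{×_σ})φ)` where `a^{×_σ} = σ(aᵀ)`. -/
def Compat (σ : RealStructure Q) (ρ : CCl Q →ₐ[ℂ] Module.End ℂ K)
    (h : SesqForm K) : Prop :=
  ∀ (a : CCl Q) (ψ φ : K),
    h.form (ρ a ψ) φ = h.form ψ (ρ (σ.toFun (CliffordAlgebra.reverse a)) φ)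

/-- Irreducibility of a representation: `K` is a simple module. -/
def IsIrreducibleRep (ρ : CCl Q →ₐ[ℂ] Module.End ℂ K) : Prop :=
  (∃ x : K, x ≠ 0) ∧
    ∀ p : Submodule ℂ K, (∀ a : CCl Q, ∀ x ∈ p, ρ a x ∈ p) → p = ⊥ ∨ p = ⊤

end Rep

section SesqForms

variable {K : Type*} [AddCommGroup K] [Module ℂ K]

namespace SesqForm

theorem im_form_self (h : SesqForm K) (x : K) : (h.form x x).im = 0 :=
  Complex.conj_eq_iff_im.1 (h.herm x x).symm

theorem form_self_eq_re (h : SesqForm K) (x : K) : h.form x x = ((h.form x x).re : ℂ) :=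
  Complex.ext (by simp) (by simp [h.im_form_self])

theorem form_zero_left (h : SesqForm K) (y : K) : h.form 0 y = 0 := by
  simpa using h.smul_left 0 0 y

theorem form_zero_right (h : SesqForm K) (y : K) : h.form y 0 = 0 := by
  simpa using h.smul_right 0 y 0

theorem form_comm_eq_zero (h : SesqForm K) {x y : K} (hxy : h.form x y = 0) :
    h.form y x = 0 := by
  rw [h.herm, hxy, map_zero]

theorem form_eq_zero_of_mem_span (h : SesqForm K) {s : Set K} {x y : K}
    (hs : ∀ z ∈ s, h.form z y = 0) (hx : x ∈ Submodule.span ℂ s) : h.form x y = 0 := by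
  induction hx using Submodule.span_induction with
  | mem z hz => exact hs z hz
  | zero => exact h.form_zero_left y
  | add u v _ _ hu hv => rw [h.add_left, hu, hv, add_zero]
  | smul a u _ hu => rw [h.smul_left, hu, mul_zero]

/-- The linear map sending `y` to the family of pairings `h (p i) y`. -/
def pairing (h : SesqForm K) {ι : Type*} (p : ι → K) : K →ₗ[ℂ] ι → ℂ where
  toFun y i := h.form (p i) y
  map_add' y z := funext fun i => h.add_right (p i) y z
  map_smul' a y := funext fun i => h.smul_right a (p i) y

/-- The orthogonal complement of a subspace. -/
def orthogonal (h : SesqForm K) (P : Submodule ℂ K) : Submodule ℂ K where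
  carrier := {y | ∀ x ∈ P, h.form x y = 0}
  add_mem' hy hz x hx := by rw [h.add_right, hy x hx, hz x hx, add_zero]
  zero_mem' x _ := h.form_zero_right x
  smul_mem' a y hy x hx := by rw [h.smul_right, hy x hx, mul_zero]

/-- The form is positive definite on the subspace `P`. -/
def PosOn (h : SesqForm K) (P : Submodule ℂ K) : Prop :=
  ∀ x ∈ P, x ≠ 0 → 0 < (h.form x x).re

theorem form_add_self_re (h : SesqForm K) (x y : K) :
    (h.form (x + y) (x + y)).re
      = (h.form x x).re + (h.form y y).re + 2 * (h.form x y).re := by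
  rw [h.add_left, h.add_right, h.add_right, h.herm x y]
  simp only [Complex.add_re, Complex.conj_re]
  ring

theorem form_smul_self_re (h : SesqForm K) (a : ℂ) (x : K) :
    (h.form (a • x) (a • x)).re = Complex.normSq a * (h.form x x).re := by
  rw [h.smul_left, h.smul_right, ← mul_assoc, ← Complex.normSq_eq_conj_mul_self,
    Complex.re_ofReal_mul]

theorem PosOn.sup_orthogonal [FiniteDimensional ℂ K] {h : SesqForm K} {P : Submodule ℂ K}
    (hP : h.PosOn P) : P ⊔ h.orthogonal P = ⊤ := by
  let b := Module.finBasis ℂ P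
  let p : Fin (Module.finrank ℂ P) → K := fun i => b i
  have hspan : Submodule.span ℂ (Set.range p) = P := by
    have h1 : Set.range p = P.subtype '' Set.range b := by
      rw [← Set.range_comp]; rfl
    rw [h1, Submodule.span_image, b.span_eq, Submodule.map_subtype_top]
  have hzero : ∀ y, h.pairing p y = 0 → ∀ x ∈ P, h.form x y = 0 := by
    intro y hy x hx
    refine h.form_eq_zero_of_mem_span (s := Set.range p) ?_ (hspan.symm ▸ hx)
    rintro _ ⟨i, rfl⟩
    exact congrFun hy i
  have hinj : Function.Injective ((h.pairing p).comp P.subtype) := by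
    rw [injective_iff_map_eq_zero]
    rintro ⟨x, hx⟩ hx0
    by_contra hne
    have := hP x hx (fun h0 => hne (by simp [h0]))
    rw [hzero x hx0 x hx] at this
    simp at this
  have hsurj := (LinearMap.injective_iff_surjective_of_finrank_eq_finrank (by simp)).1 hinj
  rw [eq_top_iff]
  intro x _
  obtain ⟨y, hy⟩ := hsurj (h.pairing p x)
  rw [Submodule.mem_sup]
  refine ⟨y, y.2, x - y, hzero _ ?_, by abel⟩
  rw [map_sub, ← hy]
  simp

theorem exists_maximal_posOn [FiniteDimensional ℂ K] (h : SesqForm K) :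
    ∃ P, h.PosOn P ∧ ∀ x ∈ h.orthogonal P, (h.form x x).re ≤ 0 := by
  obtain ⟨P, hP, hmax⟩ := WellFounded.has_min (wellFounded_gt (α := Submodule ℂ K))
    {P | h.PosOn P} ⟨⊥, fun x hx hx0 => absurd ((Submodule.mem_bot ℂ).1 hx) hx0⟩
  refine ⟨P, hP, fun x hx => ?_⟩
  by_contra! hpos
  refine hmax (P ⊔ Submodule.span ℂ {x}) ?_ ?_
  · intro y hy hy0
    obtain ⟨p, hp, z, hz, rfl⟩ := Submodule.mem_sup.1 hy
    obtain ⟨a, rfl⟩ := Submodule.mem_span_singleton.1 hz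
    rw [h.form_add_self_re, h.form_smul_self_re, h.smul_right, hx p hp]
    by_cases hp0 : p = 0
    · have ha : a ≠ 0 := by rintro rfl; simp [hp0] at hy0
      have := mul_pos (Complex.normSq_pos.2 ha) hpos
      simpa [hp0, h.form_zero_left] using this
    · have h1 := hP p hp hp0
      have := mul_nonneg (Complex.normSq_nonneg a) hpos.le
      simp only [mul_zero, Complex.zero_re]
      linarith
  · refine lt_of_le_of_ne le_sup_left fun heq => ?_
    have hxP : x ∈ P := heq ▸ Submodule.mem_sup_right (Submodule.mem_span_singleton_self x)
    rw [hx x hxP] at hpos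
    simp at hpos

/-- Cauchy–Schwarz for a negative semidefinite form: isotropic vectors are orthogonal to
everything. -/
theorem form_eq_zero_of_nonpos (h : SesqForm K) {N : Submodule ℂ K}
    (hN : ∀ x ∈ N, (h.form x x).re ≤ 0) {x y : K} (hx : x ∈ N) (hy : y ∈ N)
    (hxx : (h.form x x).re = 0) : h.form x y = 0 := by
  by_contra hne
  have hpos := Complex.normSq_pos.2 hne
  set z := h.form x y with hz
  let t : ℝ := (1 - (h.form y y).re) / (2 * Complex.normSq z)
  have key := hN _ (N.add_mem (N.smul_mem ((t : ℂ) * z) hx) hy)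
  rw [h.form_add_self_re, h.form_smul_self_re, hxx, h.smul_left, ← hz,
    map_mul (starRingEnd ℂ), Complex.conj_ofReal, mul_assoc, ← Complex.normSq_eq_conj_mul_self, ← Complex.ofReal_mul,
    Complex.ofReal_re] at key
  have ht : t * Complex.normSq z = (1 - (h.form y y).re) / 2 := by
    simp only [t]; field_simp
  rw [ht] at key
  linarith

theorem exists_orthogonal_decomposition [FiniteDimensional ℂ K] (h : SesqForm K)
    (hnd : h.Nondeg) :
    ∃ P N : Submodule ℂ K, P ⊓ N = ⊥ ∧ P ⊔ N = ⊤ ∧ (∀ x ∈ P, ∀ y ∈ N, h.form x y = 0)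
      ∧ (∀ x ∈ P, x ≠ 0 → 0 < (h.form x x).re)
      ∧ (∀ y ∈ N, y ≠ 0 → (h.form y y).re < 0) := by
  obtain ⟨P, hP, hN⟩ := h.exists_maximal_posOn
  refine ⟨P, h.orthogonal P, ?_, hP.sup_orthogonal, fun x hx y hy => hy x hx, hP, ?_⟩
  · rw [eq_bot_iff]
    rintro x ⟨hx, hx'⟩
    by_contra hne
    have := hP x hx hne
    rw [hx' x hx] at this
    simp at this
  · intro y hy hy0
    refine lt_of_le_of_ne (hN y hy) fun h0 => hy0 (hnd y fun z => ?_)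
    obtain ⟨p, hp, n, hn, rfl⟩ : ∃ p ∈ P, ∃ n ∈ h.orthogonal P, p + n = z :=
      Submodule.mem_sup.1 (hP.sup_orthogonal ▸ Submodule.mem_top)
    rw [h.add_right, h.form_comm_eq_zero (hy p hp), h.form_eq_zero_of_nonpos hN hy hn h0,
      add_zero]

theorem two_mul_finrank_le_of_map_inf_eq_bot [FiniteDimensional ℂ K] {T : K →ₗ[ℂ] K}
    (hT : Function.Injective T) {P : Submodule ℂ K} (hP : P ⊓ P.map T = ⊥) :
    2 * Module.finrank ℂ P ≤ Module.finrank ℂ K := by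
  have h1 := Submodule.finrank_sup_add_finrank_inf_eq P (P.map T)
  rw [hP, finrank_bot, ← (Submodule.equivMapOfInjective T hT P).finrank_eq] at h1
  have := Submodule.finrank_le (P ⊔ P.map T)
  lia

/-- A Krein product admitting an anti-isometry (up to a positive factor) is neutral. -/
theorem neutral_of_anti_isometry [FiniteDimensional ℂ K] (h : SesqForm K) (hnd : h.Nondeg)
    (T : K →ₗ[ℂ] K) {s : ℝ} (hs : s < 0) (hT : ∀ x y, h.form (T x) (T y) = s * h.form x y) :
    FNeutral h.form := by
  have hinj : Function.Injective T := by
    rw [injective_iff_map_eq_zero]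
    intro x hx
    refine hnd x fun y => ?_
    have := hT x y
    rw [hx, h.form_zero_left] at this
    have hs' : (s : ℂ) ≠ 0 := by exact_mod_cast hs.ne
    simpa [hs'] using this.symm
  have hTre : ∀ x, (h.form (T x) (T x)).re = s * (h.form x x).re := fun x => by
    rw [hT, Complex.re_ofReal_mul]
  obtain ⟨P, N, hinf, hsup, horth, hP, hN⟩ := h.exists_orthogonal_decomposition hnd
  refine ⟨P, N, hinf, hsup, horth, fun x hx hx0 => ⟨_, hP x hx hx0, h.form_self_eq_re x⟩,
    fun x hx hx0 => ⟨_, hN x hx hx0, h.form_self_eq_re x⟩, ?_⟩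
  have h1 : P ⊓ P.map T = ⊥ := by
    rw [eq_bot_iff]
    rintro _ ⟨hx, y, hy, rfl⟩
    by_contra hne
    have hy0 : y ≠ 0 := by rintro rfl; simp at hne
    have := hP _ hx hne
    rw [hTre] at this
    nlinarith [hP y hy hy0]
  have h2 : N ⊓ N.map T = ⊥ := by
    rw [eq_bot_iff]
    rintro _ ⟨hx, y, hy, rfl⟩
    by_contra hne
    have hy0 : y ≠ 0 := by rintro rfl; simp at hne
    have := hN _ hx hne
    rw [hTre] at this
    nlinarith [hN y hy hy0]
  have h3 := two_mul_finrank_le_of_map_inf_eq_bot hinj h1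
  have h4 := two_mul_finrank_le_of_map_inf_eq_bot hinj h2
  have h5 := Submodule.finrank_sup_add_finrank_inf_eq P N
  rw [hinf, hsup, finrank_bot, finrank_top] at h5
  lia

theorem exists_posDef [FiniteDimensional ℂ K] : ∃ g : SesqForm K, FPosDef g.form := by
  let b := Module.finBasis ℂ K
  refine ⟨{ form := fun x y => ∑ i, starRingEnd ℂ (b.repr x i) * b.repr y i
            add_left := ?_, add_right := ?_, smul_left := ?_, smul_right := ?_, herm := ?_ }, ?_⟩
  · intro x y z
    simp [add_mul, Finset.sum_add_distrib]
  · intro x y z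
    simp [mul_add, Finset.sum_add_distrib]
  · intro a x y
    simp [Finset.mul_sum, mul_assoc]
  · intro a x y
    simp [Finset.mul_sum, mul_left_comm]
  · intro x y
    simp [mul_comm]
  · intro x hx
    refine ⟨∑ i, Complex.normSq (b.repr x i), ?_, ?_⟩
    · obtain ⟨i, hi⟩ : ∃ i, b.repr x i ≠ 0 := by
        by_contra! h0
        exact hx (b.repr.map_eq_zero_iff.1 (Finsupp.ext h0))
      exact Finset.sum_pos' (fun j _ => Complex.normSq_nonneg _)
        ⟨i, Finset.mem_univ i, Complex.normSq_pos.2 hi⟩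
    · simp [Complex.normSq_eq_conj_mul_self]

/-- The form `g + c⁻¹ T^* g`, for which `T` is self-adjoint as soon as `T² = c`. -/
def average (g : SesqForm K) (T : K →ₗ[ℂ] K) (c : ℝ) : SesqForm K where
  form x y := g.form x y + (c⁻¹ : ℝ) * g.form (T x) (T y)
  add_left x y z := by rw [map_add, g.add_left, g.add_left]; ring
  add_right x y z := by rw [map_add, g.add_right, g.add_right]; ring
  smul_left a x y := by rw [map_smul, g.smul_left, g.smul_left]; ring
  smul_right a x y := by rw [map_smul, g.smul_right, g.smul_right]; ring
  herm x y := by rw [g.herm x y, g.herm (T x) (T y)]; simp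

theorem FPosDef.re_pos {g : SesqForm K} (hg : FPosDef g.form) {x : K} (hx : x ≠ 0) :
    0 < (g.form x x).re := by
  obtain ⟨r, hr, hrx⟩ := hg x hx
  rwa [hrx, Complex.ofReal_re]

theorem FPosDef.re_nonneg {g : SesqForm K} (hg : FPosDef g.form) (x : K) :
    0 ≤ (g.form x x).re := by
  by_cases hx : x = 0
  · rw [hx, g.form_zero_left]; simp
  · exact (FPosDef.re_pos hg hx).le

/-- Finitely many anticommuting operators with positive squares are simultaneously
self-adjoint for some positive definite form. -/
theorem exists_posDef_selfAdjoint [FiniteDimensional ℂ K] {ι : Type*} (E : ι → K →ₗ[ℂ] K)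
    (c : ι → ℝ) (hc : ∀ i, 0 < c i) (hsq : ∀ i x, E i (E i x) = (c i : ℂ) • x)
    (hanti : ∀ i j, i ≠ j → ∀ x, E i (E j x) = -E j (E i x)) (s : Finset ι) :
    ∃ g : SesqForm K, FPosDef g.form ∧
      ∀ i ∈ s, ∀ x y, g.form (E i x) y = g.form x (E i y) := by
  classical
  induction s using Finset.induction_on with
  | empty =>
    obtain ⟨g, hg⟩ := exists_posDef (K := K)
    exact ⟨g, hg, by simp⟩
  | insert k s hk ih =>
    obtain ⟨g, hg, hs⟩ := ih
    have hc0 : (c k : ℂ) ≠ 0 := by exact_mod_cast (hc k).ne'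
    refine ⟨g.average (E k) (c k), ?_, ?_⟩
    · intro x hx
      refine ⟨_, ?_, form_self_eq_re _ x⟩
      have h1 := FPosDef.re_pos hg hx
      have h2 := mul_nonneg (inv_pos.2 (hc k)).le (FPosDef.re_nonneg hg (E k x))
      simp only [average, Complex.add_re, Complex.re_ofReal_mul]
      linarith
    · intro i hi x y
      rcases Finset.mem_insert.1 hi with rfl | hi
      · simp only [average, hsq, g.smul_left, g.smul_right, Complex.conj_ofReal,
          Complex.ofReal_inv]
        field_simp
        ring
      · have hne : k ≠ i := by rintro rfl; exact hk hi
        have hneg : ∀ u v, g.form (-u) v = -g.form u v := fun u v => by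
          simpa using g.smul_left (-1) u v
        have hneg' : ∀ u v, g.form u (-v) = -g.form u v := fun u v => by
          simpa using g.smul_right (-1) u v
        simp only [average]
        rw [hs i hi, hanti k i hne, hanti k i hne, hneg, hneg', hs i hi]

/-- Relative to a positive definite form, every hermitian form has an eigenvector. -/
theorem exists_eigenvector [FiniteDimensional ℂ K] [Nontrivial K] (g h : SesqForm K)
    (hg : FPosDef g.form) :
    ∃ (μ : ℂ) (y : K), y ≠ 0 ∧ ∀ x, h.form x y = μ * g.form x y := by
  let b := Module.finBasis ℂ K
  have hinj : Function.Injective (g.pairing b) := by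
    rw [injective_iff_map_eq_zero]
    intro x hx
    by_contra hne
    have := FPosDef.re_pos hg hne
    rw [g.form_eq_zero_of_mem_span (s := Set.range b) (by
      rintro _ ⟨i, rfl⟩
      exact congrFun hx i) (by rw [b.span_eq]; trivial)] at this
    simp at this
  let e := LinearEquiv.ofInjectiveOfFinrankEq (g.pairing b) hinj (by simp)
  have he : ∀ x, e x = g.pairing b x := fun x => rfl
  obtain ⟨μ, hμ⟩ := Module.End.exists_eigenvalue
    ((e.symm : (Fin (Module.finrank ℂ K) → ℂ) →ₗ[ℂ] K).comp (h.pairing b))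
  obtain ⟨y, hy⟩ := hμ.exists_hasEigenvector
  refine ⟨μ, y, hy.2, fun x => ?_⟩
  have h1 : h.pairing b y = μ • g.pairing b y := by
    have := hy.apply_eq_smul
    rw [LinearMap.comp_apply, LinearEquiv.coe_coe, LinearEquiv.symm_apply_eq, map_smul, he] at this
    exact this
  have hx : x ∈ Submodule.span ℂ (Set.range b) := by rw [b.span_eq]; trivial
  induction hx using Submodule.span_induction with
  | mem z hz => obtain ⟨i, rfl⟩ := hz; exact congrFun h1 i
  | zero => simp [form_zero_left]
  | add u v _ _ hu hv => rw [h.add_left, g.add_left, hu, hv, mul_add]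
  | smul a u _ hu => rw [h.smul_left, g.smul_left, hu]; ring

/-- A Krein product proportional to a positive definite form is definite. -/
theorem definite_of_eq_mul [Nontrivial K] (g h : SesqForm K) (hg : FPosDef g.form)
    (hnd : h.Nondeg) {μ : ℂ} (hμ : ∀ x y, h.form x y = μ * g.form x y) : FDefinite h.form := by
  have hre : ∀ x, (h.form x x).re = μ.re * (g.form x x).re := fun x => by
    rw [hμ, g.form_self_eq_re, Complex.re_mul_ofReal, Complex.ofReal_re]
  obtain ⟨x₀, hx₀⟩ := exists_ne (0 : K)
  have him : μ.im = 0 := by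
    have h1 := h.im_form_self x₀
    rw [hμ, g.form_self_eq_re, Complex.im_mul_ofReal] at h1
    exact (mul_eq_zero.1 h1).resolve_right (FPosDef.re_pos hg hx₀).ne'
  have hne : μ.re ≠ 0 := fun h0 => hx₀ (hnd x₀ fun y => by
    rw [hμ, show μ = 0 from Complex.ext h0 him, zero_mul])
  rcases lt_or_gt_of_ne hne with hlt | hgt
  · exact Or.inr fun x hx => ⟨_, by
      rw [hre]; exact mul_neg_of_neg_of_pos hlt (FPosDef.re_pos hg hx), h.form_self_eq_re x⟩
  · exact Or.inl fun x hx => ⟨_, by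
      rw [hre]; exact mul_pos hgt (FPosDef.re_pos hg hx), h.form_self_eq_re x⟩

end SesqForm

end SesqForms

section CliffordFacts

variable {Q : QuadraticForm ℝ V}

theorem ofReal_smul_tensor (r : ℝ) (m : ℂ ⊗[ℝ] V) : (r : ℂ) • m = r • m :=
  algebraMap_smul ℂ r m

theorem CCl.ι_injective : Function.Injective (CliffordAlgebra.ι (Q.baseChange ℂ)) := by
  intro m n hmn
  have h := congrArg (CliffordAlgebra.changeForm
    (CliffordAlgebra.changeForm.associated_neg_proof (Q := Q.baseChange ℂ))) hmn
  rw [CliffordAlgebra.changeForm_ι, CliffordAlgebra.changeForm_ι] at h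
  exact (ExteriorAlgebra.ι_inj ℂ m n).1 h

theorem ιr_mul_add_swap (v w : V) :
    ιr Q v * ιr Q w + ιr Q w * ιr Q v
      = algebraMap ℂ (CCl Q) ((QuadraticMap.polar Q v w : ℝ) : ℂ) := by
  rw [ιr, ιr, CliffordAlgebra.ι_mul_ι_add_swap, QuadraticMap.polar, ← TensorProduct.tmul_add]
  simp [QuadraticForm.baseChange_tmul, QuadraticMap.polar]

theorem ιr_mem_VC (v : V) : ιr Q v ∈ VC Q := ⟨_, rfl⟩

namespace RealStructure

theorem map_algebraMap (σ : RealStructure Q) (z : ℂ) :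
    σ.toFun (algebraMap ℂ (CCl Q) z) = algebraMap ℂ (CCl Q) (starRingEnd ℂ z) := by
  rw [Algebra.algebraMap_eq_smul_one, σ.map_smul', σ.map_one', Algebra.algebraMap_eq_smul_one]

theorem map_neg (σ : RealStructure Q) (x : CCl Q) : σ.toFun (-x) = -σ.toFun x := by
  simpa using σ.map_smul' (-1) x

/-- The fixed vectors of a real structure, as a subspace of `ℂ ⊗ V`. -/
def fixedVectors (σ : RealStructure Q) : Submodule ℝ (ℂ ⊗[ℝ] V) :=
  (fixedPoints σ).comap ((CliffordAlgebra.ι (Q.baseChange ℂ)).restrictScalars ℝ)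

theorem mem_fixedVectors {σ : RealStructure Q} {m : ℂ ⊗[ℝ] V} :
    m ∈ σ.fixedVectors ↔
      σ.toFun (CliffordAlgebra.ι (Q.baseChange ℂ) m) = CliffordAlgebra.ι (Q.baseChange ℂ) m :=
  Iff.rfl

/-- The real bilinear form induced by the polar form on the fixed vectors. -/
def fixedPolar (σ : RealStructure Q) : LinearMap.BilinForm ℝ σ.fixedVectors :=
  LinearMap.mk₂ ℝ (fun m n => (QuadraticMap.polar (Q.baseChange ℂ) (m : ℂ ⊗[ℝ] V) n).re)
    (fun m m' n => by simp [QuadraticMap.polar_add_left])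
    (fun r m n => by
      rw [Submodule.coe_smul, ← ofReal_smul_tensor, QuadraticMap.polar_smul_left]
      simp)
    (fun m n n' => by simp [QuadraticMap.polar_add_right])
    (fun r m n => by
      rw [Submodule.coe_smul, ← ofReal_smul_tensor, QuadraticMap.polar_smul_right]
      simp)

theorem fixedPolar_isSymm (σ : RealStructure Q) : LinearMap.IsSymm σ.fixedPolar :=
  ⟨fun m n => by simp [fixedPolar, QuadraticMap.polar_comm]⟩

theorem ι_mul_add_swap_of_fixed (σ : RealStructure Q) (m n : σ.fixedVectors) :
    CliffordAlgebra.ι (Q.baseChange ℂ) m * CliffordAlgebra.ι (Q.baseChange ℂ) n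
      + CliffordAlgebra.ι (Q.baseChange ℂ) n * CliffordAlgebra.ι (Q.baseChange ℂ) m
      = algebraMap ℂ (CCl Q) ((σ.fixedPolar m n : ℝ) : ℂ) := by
  have h1 := CliffordAlgebra.ι_mul_ι_add_swap (Q := Q.baseChange ℂ) (m : ℂ ⊗[ℝ] V) n
  have h2 := congrArg σ.toFun h1
  rw [σ.map_add', σ.map_mul', σ.map_mul', mem_fixedVectors.1 m.2, mem_fixedVectors.1 n.2, h1,
    σ.map_algebraMap] at h2
  have h3 := Complex.conj_eq_iff_re.1 ((algebraMap ℂ (CCl Q)).injective h2).symm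
  rw [h1, ← h3]
  simp [fixedPolar]

theorem exists_fixedVectors_add (σ : RealStructure Q) {x : CCl Q} (hx : x ∈ VC Q) :
    ∃ m : σ.fixedVectors, CliffordAlgebra.ι (Q.baseChange ℂ) m = x + σ.toFun x := by
  obtain ⟨m, hm⟩ := (VC Q).add_mem hx (σ.stable x hx)
  refine ⟨⟨m, ?_⟩, hm⟩
  rw [mem_fixedVectors, hm, σ.map_add', σ.invol, add_comm]

theorem exists_fixedVectors_sub (σ : RealStructure Q) {x : CCl Q} (hx : x ∈ VC Q) :
    ∃ m : σ.fixedVectors,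
      CliffordAlgebra.ι (Q.baseChange ℂ) m = Complex.I • (x - σ.toFun x) := by
  obtain ⟨m, hm⟩ := (VC Q).smul_mem Complex.I ((VC Q).sub_mem hx (σ.stable x hx))
  refine ⟨⟨m, ?_⟩, hm⟩
  rw [mem_fixedVectors, hm, σ.map_smul', sub_eq_add_neg, σ.map_add', σ.map_neg, σ.invol,
    Complex.conj_I, neg_smul, ← smul_neg, neg_add, neg_neg, add_comm]

theorem eq_smul_add_smul (σ : RealStructure Q) (x : CCl Q) :
    x = (1 / 2 : ℂ) • (x + σ.toFun x)
      + (-Complex.I / 2) • (Complex.I • (x - σ.toFun x)) := by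
  have h : -Complex.I / 2 * Complex.I = 1 / 2 := by
    linear_combination (-1 / 2 : ℂ) * Complex.I_mul_I
  rw [smul_smul, h, ← smul_add]
  rw [show x + σ.toFun x + (x - σ.toFun x) = (2 : ℂ) • x by rw [two_smul]; abel, smul_smul]
  norm_num

/-- `V^ℂ` is the complex span of the fixed vectors. -/
theorem mem_span_fixedVectors (σ : RealStructure Q) {x : CCl Q} (hx : x ∈ VC Q) :
    x ∈ Submodule.span ℂ
      (CliffordAlgebra.ι (Q.baseChange ℂ) '' (σ.fixedVectors : Set (ℂ ⊗[ℝ] V))) := by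
  obtain ⟨m, hm⟩ := σ.exists_fixedVectors_add hx
  obtain ⟨n, hn⟩ := σ.exists_fixedVectors_sub hx
  rw [σ.eq_smul_add_smul x, ← hm, ← hn]
  exact Submodule.add_mem _
    (Submodule.smul_mem _ _ (Submodule.subset_span ⟨m, m.2, rfl⟩))
    (Submodule.smul_mem _ _ (Submodule.subset_span ⟨n, n.2, rfl⟩))

end RealStructure

end CliffordFacts

section QuadraticFormOfRealStructure

variable {Q : QuadraticForm ℝ V}
  {σ : RealStructure Q} {Qσ : V → ℝ}

namespace RealStructure

/-- The real-linear map `V × V → ℂl(V)`, `(a, b) ↦ σ(a) + i b`. -/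
def conjAddI (σ : RealStructure Q) : V × V →ₗ[ℝ] CCl Q where
  toFun p := σ.toFun (ιr Q p.1) + Complex.I • ιr Q p.2
  map_add' p q := by
    simp only [ιr, Prod.fst_add, Prod.snd_add, TensorProduct.tmul_add, map_add, σ.map_add',
      smul_add]
    abel
  map_smul' r p := by
    have h : ∀ v, ιr Q (r • v) = (r : ℂ) • ιr Q v := fun v => by
      rw [ιr, ιr, ← map_smul, TensorProduct.tmul_smul, ofReal_smul_tensor]
    simp only [Prod.smul_fst, Prod.smul_snd, h, σ.map_smul', Complex.conj_ofReal,
      RingHom.id_apply]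
    rw [smul_comm Complex.I, ← smul_add, Complex.coe_smul]

theorem conjAddI_mul_swap
    (hQσ : ∀ v : V, σ.toFun (ιr Q v) * ιr Q v + ιr Q v * σ.toFun (ιr Q v)
      = algebraMap ℂ (CCl Q) ((2 * Qσ v : ℝ) : ℂ)) (p : V × V) :
    σ.toFun (σ.conjAddI p) * σ.conjAddI p + σ.conjAddI p * σ.toFun (σ.conjAddI p)
      = algebraMap ℂ (CCl Q) ((2 * (Qσ p.1 + Qσ p.2) : ℝ) : ℂ) := by
  obtain ⟨a, b⟩ := p
  have h1 := ιr_mul_add_swap (Q := Q) a b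
  have h2 := congrArg σ.toFun h1
  rw [σ.map_add', σ.map_mul', σ.map_mul', σ.map_algebraMap, Complex.conj_ofReal, ← h1] at h2
  have hI : ∀ x : CCl Q, Complex.I • Complex.I • x = -x := fun x => by
    rw [smul_smul, Complex.I_mul_I, neg_one_smul]
  have h3 : σ.toFun (σ.conjAddI (a, b)) = ιr Q a - Complex.I • σ.toFun (ιr Q b) := by
    simp only [conjAddI, LinearMap.coe_mk, AddHom.coe_mk]
    rw [σ.map_add', σ.invol, σ.map_smul', Complex.conj_I, neg_smul, sub_eq_add_neg]
  rw [h3, mul_add, Complex.ofReal_add, map_add, ← hQσ a, ← hQσ b]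
  simp only [conjAddI, LinearMap.coe_mk, AddHom.coe_mk, sub_mul, mul_add, add_mul, mul_sub,
    smul_mul_assoc, mul_smul_comm, smul_sub, smul_add, hI]
  linear_combination (norm := module) (-Complex.I) • h2

theorem conjAddI_injective
    (hQσ : ∀ v : V, σ.toFun (ιr Q v) * ιr Q v + ιr Q v * σ.toFun (ιr Q v)
      = algebraMap ℂ (CCl Q) ((2 * Qσ v : ℝ) : ℂ)) (hnn : ∀ v, 0 ≤ Qσ v)
    (hpos : ∀ v : V, v ≠ 0 → 0 < Qσ v) : Function.Injective σ.conjAddI := by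
  rw [injective_iff_map_eq_zero]
  intro p hp
  have h := conjAddI_mul_swap hQσ p
  rw [hp, mul_zero, zero_mul, add_zero, ← map_zero (algebraMap ℂ (CCl Q))] at h
  have h' : 2 * (Qσ p.1 + Qσ p.2) = 0 := by
    exact_mod_cast ((algebraMap ℂ (CCl Q)).injective h).symm
  by_contra hne
  have : p.1 ≠ 0 ∨ p.2 ≠ 0 := by
    by_contra! h0
    exact hne (Prod.ext h0.1 h0.2)
  rcases this with h1 | h1
  · linarith [hpos _ h1, hnn p.2]
  · linarith [hpos _ h1, hnn p.1]

theorem apply_zero_eq_zero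
    (hQσ : ∀ v : V, σ.toFun (ιr Q v) * ιr Q v + ιr Q v * σ.toFun (ιr Q v)
      = algebraMap ℂ (CCl Q) ((2 * Qσ v : ℝ) : ℂ)) : Qσ 0 = 0 := by
  have h := hQσ 0
  rw [show ιr Q 0 = 0 by simp [ιr], mul_zero, zero_mul, add_zero,
    ← map_zero (algebraMap ℂ (CCl Q))] at h
  have h' : 2 * Qσ 0 = 0 := by exact_mod_cast ((algebraMap ℂ (CCl Q)).injective h).symm
  linarith

/-- If `Q_σ` is positive definite on `V`, the polar form is positive definite on the vectors
fixed by `σ`. -/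
theorem fixedPolar_pos [FiniteDimensional ℝ V]
    (hQσ : ∀ v : V, σ.toFun (ιr Q v) * ιr Q v + ιr Q v * σ.toFun (ιr Q v)
      = algebraMap ℂ (CCl Q) ((2 * Qσ v : ℝ) : ℂ)) (hpos : ∀ v : V, v ≠ 0 → 0 < Qσ v)
    (m : σ.fixedVectors) (hm : m ≠ 0) : 0 < σ.fixedPolar m m := by
  have hnn : ∀ v, 0 ≤ Qσ v := fun v => by
    by_cases hv : v = 0
    · rw [hv, apply_zero_eq_zero hQσ]
    · exact (hpos v hv).le
  have hinj := conjAddI_injective hQσ hnn hpos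
  have hle : LinearMap.range σ.conjAddI ≤ (VC Q).restrictScalars ℝ := by
    rintro _ ⟨p, rfl⟩
    exact (VC Q).add_mem (σ.stable _ (ιr_mem_VC _)) ((VC Q).smul_mem _ (ιr_mem_VC _))
  have hfin : Module.finrank ℝ (ℂ ⊗[ℝ] V) = 2 * Module.finrank ℝ V := by
    rw [Module.finrank_tensorProduct, Complex.finrank_real_complex]
  have hVC : (VC Q).restrictScalars ℝ
      = LinearMap.range ((CliffordAlgebra.ι (Q.baseChange ℂ)).restrictScalars ℝ) := rfl
  have : FiniteDimensional ℝ ((VC Q).restrictScalars ℝ) := by rw [hVC]; infer_instance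
  have heq : LinearMap.range σ.conjAddI = (VC Q).restrictScalars ℝ := by
    refine Submodule.eq_of_le_of_finrank_le hle ?_
    rw [LinearMap.finrank_range_of_inj hinj, Module.finrank_prod, ← two_mul, ← hfin, hVC]
    exact LinearMap.finrank_range_le _
  obtain ⟨p, hp⟩ : CliffordAlgebra.ι (Q.baseChange ℂ) (m : ℂ ⊗[ℝ] V)
      ∈ LinearMap.range σ.conjAddI := heq ▸ ⟨(m : ℂ ⊗[ℝ] V), rfl⟩
  have h := conjAddI_mul_swap hQσ p
  rw [hp, mem_fixedVectors.1 m.2, ι_mul_add_swap_of_fixed] at h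
  have h' : σ.fixedPolar m m = 2 * (Qσ p.1 + Qσ p.2) := by
    exact_mod_cast (algebraMap ℂ (CCl Q)).injective h
  have hp0 : p.1 ≠ 0 ∨ p.2 ≠ 0 := by
    by_contra! h0
    rw [show p = 0 from Prod.ext h0.1 h0.2, map_zero] at hp
    exact hm (Subtype.ext (CCl.ι_injective (by rw [← hp]; simp)))
  rcases hp0 with h1 | h1
  · linarith [hpos _ h1, hnn p.2]
  · linarith [hpos _ h1, hnn p.1]

/-- An isotropic vector of a positive semidefinite symmetric form lies in its radical. -/
theorem _root_.LinearMap.BilinForm.apply_eq_zero_of_nonneg {W : Type*} [AddCommGroup W]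
    [Module ℝ W] {B : LinearMap.BilinForm ℝ W} (hB : LinearMap.IsSymm B) (hnn : ∀ w, 0 ≤ B w w) {a : W}
    (ha : B a a = 0) (u : W) : B a u = 0 := by
  by_contra hne
  have h := hnn (u + (-(B u u + 1) / (2 * B a u)) • a)
  have hs : B u a = B a u := hB.eq u a
  simp only [map_add, map_smul, LinearMap.add_apply, LinearMap.smul_apply, smul_eq_mul, ha,
    hs] at h
  have : -(B u u + 1) / (2 * B a u) * B a u = -(B u u + 1) / 2 := by field_simp
  rw [this] at h
  linarith

/-- If `Q_σ` is not positive definite, some vector fixed by `σ` has negative square. -/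
theorem exists_fixedPolar_neg (hQ : QFNondeg Q)
    (hQσ : ∀ v : V, σ.toFun (ιr Q v) * ιr Q v + ιr Q v * σ.toFun (ιr Q v)
      = algebraMap ℂ (CCl Q) ((2 * Qσ v : ℝ) : ℂ)) (hpos : ¬ ∀ v : V, v ≠ 0 → 0 < Qσ v) :
    ∃ m : σ.fixedVectors, σ.fixedPolar m m < 0 := by
  by_contra! hnn
  refine hpos fun v hv => ?_
  by_contra! hle
  obtain ⟨a, ha⟩ := σ.exists_fixedVectors_add (ιr_mem_VC (Q := Q) v)
  obtain ⟨b, hb⟩ := σ.exists_fixedVectors_sub (ιr_mem_VC (Q := Q) v)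
  have hsum : σ.fixedPolar a a + σ.fixedPolar b b = 4 * (2 * Qσ v) := by
    have h : algebraMap ℂ (CCl Q) ((σ.fixedPolar a a + σ.fixedPolar b b : ℝ) : ℂ)
        = algebraMap ℂ (CCl Q) ((4 * (2 * Qσ v) : ℝ) : ℂ) := by
      rw [Complex.ofReal_add, map_add, ← ι_mul_add_swap_of_fixed, ← ι_mul_add_swap_of_fixed,
        Complex.ofReal_mul, map_mul, ← hQσ v, ha, hb]
      simp only [smul_mul_assoc, mul_smul_comm, smul_smul, Complex.I_mul_I, neg_one_smul]
      have h4 : algebraMap ℂ (CCl Q) ((4 : ℝ) : ℂ) = 4 := by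
        rw [Complex.ofReal_ofNat, map_ofNat]
      rw [h4]
      noncomm_ring
    exact_mod_cast (algebraMap ℂ (CCl Q)).injective h
  have ha0 : σ.fixedPolar a a = 0 := by linarith [hnn a, hnn b]
  have hb0 : σ.fixedPolar b b = 0 := by linarith [hnn a, hnn b]
  have hrad : ∀ y ∈ VC Q, ∀ c : σ.fixedVectors, σ.fixedPolar c c = 0 →
      CliffordAlgebra.ι (Q.baseChange ℂ) c * y
        + y * CliffordAlgebra.ι (Q.baseChange ℂ) c = 0 := by
    intro y hy c hc
    replace hy := σ.mem_span_fixedVectors hy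
    induction hy using Submodule.span_induction with
    | mem z hz =>
      obtain ⟨u, hu, rfl⟩ := hz
      rw [ι_mul_add_swap_of_fixed σ c ⟨u, hu⟩,
        LinearMap.BilinForm.apply_eq_zero_of_nonneg σ.fixedPolar_isSymm hnn hc]
      simp
    | zero => simp
    | add s t _ _ hs ht =>
      rw [mul_add, add_mul, add_add_add_comm, hs, ht, add_zero]
    | smul z t _ ht => rw [mul_smul_comm, smul_mul_assoc, ← smul_add, ht, smul_zero]
  refine hv (hQ v fun w => ?_)
  have h := ιr_mul_add_swap (Q := Q) v w
  have h1 := hrad _ (ιr_mem_VC w) a ha0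
  have h2 := hrad _ (ιr_mem_VC w) b hb0
  have h3 : ιr Q v * ιr Q w + ιr Q w * ιr Q v = 0 := by
    rw [σ.eq_smul_add_smul (ιr Q v), ← ha, ← hb, add_mul, mul_add, smul_mul_assoc,
      smul_mul_assoc, mul_smul_comm, mul_smul_comm, add_add_add_comm, ← smul_add, ← smul_add,
      h1, h2, smul_zero, smul_zero, add_zero]
  rw [h3, ← map_zero (algebraMap ℂ (CCl Q))] at h
  exact_mod_cast ((algebraMap ℂ (CCl Q)).injective h).symm

end RealStructure

end QuadraticFormOfRealStructure

section Representations

variable {Q : QuadraticForm ℝ V}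
  {σ : RealStructure Q} {K : Type*} [AddCommGroup K] [Module ℂ K]

theorem Compat.form_fixed {ρ : CCl Q →ₐ[ℂ] Module.End ℂ K} {h : SesqForm K}
    (hcompat : Compat σ ρ h) (m : σ.fixedVectors) (x y : K) :
    h.form (ρ (CliffordAlgebra.ι (Q.baseChange ℂ) m) x) y
      = h.form x (ρ (CliffordAlgebra.ι (Q.baseChange ℂ) m) y) := by
  rw [hcompat, CliffordAlgebra.reverse_ι, RealStructure.mem_fixedVectors.1 m.2]

theorem rep_fixed_swap (ρ : CCl Q →ₐ[ℂ] Module.End ℂ K) (m n : σ.fixedVectors) (x : K) :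
    ρ (CliffordAlgebra.ι (Q.baseChange ℂ) m) (ρ (CliffordAlgebra.ι (Q.baseChange ℂ) n) x)
      + ρ (CliffordAlgebra.ι (Q.baseChange ℂ) n) (ρ (CliffordAlgebra.ι (Q.baseChange ℂ) m) x)
      = ((σ.fixedPolar m n : ℝ) : ℂ) • x := by
  have h := congrArg (fun a => ρ a x) (σ.ι_mul_add_swap_of_fixed m n)
  simp only [map_add, map_mul, Algebra.algebraMap_eq_smul_one, map_smul, map_one] at h
  exact h

theorem rep_fixed_sq (ρ : CCl Q →ₐ[ℂ] Module.End ℂ K) (m : σ.fixedVectors) (x : K) :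
    ρ (CliffordAlgebra.ι (Q.baseChange ℂ) m) (ρ (CliffordAlgebra.ι (Q.baseChange ℂ) m) x)
      = ((σ.fixedPolar m m / 2 : ℝ) : ℂ) • x := by
  have h := rep_fixed_swap ρ m m x
  rw [← two_smul ℂ] at h
  rw [Complex.ofReal_div, Complex.ofReal_ofNat, div_eq_inv_mul, ← smul_smul, ← h, smul_smul]
  norm_num

theorem neutral_of_fixedPolar_neg [FiniteDimensional ℂ K] (ρ : CCl Q →ₐ[ℂ] Module.End ℂ K)
    (h : SesqForm K) (hnd : h.Nondeg) (hcompat : Compat σ ρ h) (m : σ.fixedVectors)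
    (hm : σ.fixedPolar m m < 0) : FNeutral h.form := by
  refine h.neutral_of_anti_isometry hnd (ρ (CliffordAlgebra.ι (Q.baseChange ℂ) m))
    (s := σ.fixedPolar m m / 2) (by linarith) fun x y => ?_
  rw [hcompat.form_fixed, rep_fixed_sq, h.smul_right]

theorem definite_of_fixedPolar_pos [FiniteDimensional ℝ V] [FiniteDimensional ℂ K]
    (ρ : CCl Q →ₐ[ℂ] Module.End ℂ K) (hirr : IsIrreducibleRep ρ) (h : SesqForm K)
    (hnd : h.Nondeg) (hcompat : Compat σ ρ h)
    (hpos : ∀ m : σ.fixedVectors, m ≠ 0 → 0 < σ.fixedPolar m m) : FDefinite h.form := by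
  have : Nontrivial K := let ⟨x, hx⟩ := hirr.1; ⟨x, 0, hx⟩
  obtain ⟨e, he⟩ := LinearMap.BilinForm.exists_orthogonal_basis σ.fixedPolar_isSymm
  obtain ⟨g, hg, hE⟩ := SesqForm.exists_posDef_selfAdjoint
    (fun i => ρ (CliffordAlgebra.ι (Q.baseChange ℂ) (e i : ℂ ⊗[ℝ] V)))
    (fun i => σ.fixedPolar (e i) (e i) / 2) (fun i => half_pos (hpos _ (e.ne_zero i)))
    (fun i x => rep_fixed_sq ρ (e i) x)
    (fun i j hij x => by
      have h0 : σ.fixedPolar (e i) (e j) = 0 := he hij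
      have h1 := rep_fixed_swap ρ (e i) (e j) x
      rw [h0, Complex.ofReal_zero, zero_smul] at h1
      exact eq_neg_of_add_eq_zero_left h1)
    Finset.univ
  obtain ⟨μ, y₀, hy₀, hμ⟩ := SesqForm.exists_eigenvector g h hg
  let R : Submodule ℂ K :=
    { carrier := {y | ∀ x, h.form x y = μ * g.form x y}
      add_mem' := fun hy hz x => by rw [h.add_right, g.add_right, hy x, hz x, mul_add]
      zero_mem' := fun x => by simp [SesqForm.form_zero_right]
      smul_mem' := fun a y hy x => by rw [h.smul_right, g.smul_right, hy x]; ring }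
  have hbasis : ∀ i, ∀ y ∈ R, ρ (CliffordAlgebra.ι (Q.baseChange ℂ) (e i : ℂ ⊗[ℝ] V)) y ∈ R := by
    intro i y hy x
    rw [← hcompat.form_fixed, hy, hE i (Finset.mem_univ i)]
  have hfixed : ∀ m : σ.fixedVectors, ∀ y ∈ R,
      ρ (CliffordAlgebra.ι (Q.baseChange ℂ) m) y ∈ R := by
    intro m y hy
    have hm : m ∈ Submodule.span ℝ (Set.range e) := by rw [e.span_eq]; trivial
    induction hm using Submodule.span_induction with
    | mem z hz => obtain ⟨i, rfl⟩ := hz; exact hbasis i y hy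
    | zero => simp
    | add u v _ _ hu hv =>
      rw [Submodule.coe_add, map_add, map_add, LinearMap.add_apply]
      exact R.add_mem hu hv
    | smul r u _ hu =>
      rw [Submodule.coe_smul, ← ofReal_smul_tensor, map_smul, map_smul, LinearMap.smul_apply]
      exact R.smul_mem _ hu
  have hR : ∀ a : CCl Q, ∀ y ∈ R, ρ a y ∈ R := by
    intro a
    induction a using CliffordAlgebra.induction with
    | algebraMap r =>
      intro y hy
      simpa [Algebra.algebraMap_eq_smul_one] using R.smul_mem r hy
    | ι m =>
      intro y hy
      have hm := σ.mem_span_fixedVectors (x := CliffordAlgebra.ι (Q.baseChange ℂ) m) ⟨m, rfl⟩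
      generalize CliffordAlgebra.ι (Q.baseChange ℂ) m = x at hm ⊢
      induction hm using Submodule.span_induction with
      | mem z hz => obtain ⟨u, hu, rfl⟩ := hz; exact hfixed ⟨u, hu⟩ y hy
      | zero => simp
      | add u v _ _ hu hv => rw [map_add, LinearMap.add_apply]; exact R.add_mem hu hv
      | smul r u _ hu => rw [map_smul, LinearMap.smul_apply]; exact R.smul_mem _ hu
    | mul a b ha hb => intro y hy; rw [map_mul]; exact ha _ (hb y hy)
    | add a b ha hb =>
      intro y hy
      rw [map_add, LinearMap.add_apply]
      exact R.add_mem (ha y hy) (hb y hy)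
  have hRtop : R = ⊤ := (hirr.2 R hR).resolve_left fun h0 =>
    hy₀ ((Submodule.mem_bot ℂ).1 (h0 ▸ (show y₀ ∈ R from hμ)))
  exact SesqForm.definite_of_eq_mul g h hg hnd fun x y =>
    (hRtop ▸ Submodule.mem_top : y ∈ R) x

end Representations

/-- **Robinson's alternative.** Let `σ` be a real structure, `K` an irreducible
`ℂl(V)`-module and `(·,·)^K` a σ-compatible Krein product on `K`. If `Q_σ` is positive
definite then `(·,·)^K` is definite; otherwise it is neutral. -/
theorem statement12 [FiniteDimensional ℝ V] (Q : QuadraticForm ℝ V)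
    (hdim : Even (Module.finrank ℝ V)) (hQ : QFNondeg Q)
    (σ : RealStructure Q)
    (Qσ : V → ℝ)
    (hQσ : ∀ v : V, σ.toFun (ιr Q v) * ιr Q v + ιr Q v * σ.toFun (ιr Q v)
        = algebraMap ℂ (CCl Q) ((2 * Qσ v : ℝ) : ℂ))
    {K : Type*} [AddCommGroup K] [Module ℂ K] [FiniteDimensional ℂ K]
    (ρ : CCl Q →ₐ[ℂ] Module.End ℂ K) (hirr : IsIrreducibleRep ρ)
    (h : SesqForm K) (hnd : h.Nondeg) (hcompat : Compat σ ρ h) :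
    ((∀ v : V, v ≠ 0 → 0 < Qσ v) → FDefinite h.form)
    ∧ (¬ (∀ v : V, v ≠ 0 → 0 < Qσ v) → FNeutral h.form) := by
  exact ⟨fun hpos => definite_of_fixedPolar_pos ρ hirr h hnd hcompat
      (RealStructure.fixedPolar_pos hQσ hpos), fun hpos =>
    let ⟨m, hm⟩ := RealStructure.exists_fixedPolar_neg hQ hQσ hpos
    neutral_of_fixedPolar_neg ρ h hnd hcompat m hm⟩
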